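/- Let F be a finite union-closed family of finite sets with ∅ ∈ F, let U ⊆ ⋃F, and let F' be an extension of (F, U). Then F' is also an extension of (𝒩³_F(U), U) and μ_{F,F'}(U) = μ_{𝒩³_F(U),F'}(U). -/

import Mathlib

open Finset

/-- `F` is union-closed. -/
def UnionClosed {α : Type*} [DecidableEq α] (F : Finset (Finset α)) : Prop :=
  ∀ A ∈ F, ∀ B ∈ F, A ∪ B ∈ F

/-- The generators `J(F)`: nonempty members of `F` that are not the union of the
members of `F` properly contained in them. -/
def gens {α : Type*} [DecidableEq α] (F : Finset (Finset α)) : Finset (Finset α) :=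
  F.filter (fun U => U.Nonempty ∧ (F.filter (fun A => A ⊂ U)).sup id ≠ U)

/-- The closure `π_F(X)`: the union of all members of `F` contained in `X`. -/
def piF {α : Type*} [DecidableEq α] (F : Finset (Finset α)) (X : Finset α) : Finset α :=
  (F.filter (fun A => A ⊆ X)).sup id

/-- `F ∨ H = {A ∪ B : A ∈ F, B ∈ H}`. -/
def famJoin {α : Type*} [DecidableEq α] (F H : Finset (Finset α)) : Finset (Finset α) :=
  (F ×ˢ H).image (fun p => p.1 ∪ p.2)

/-- `F'` is an extension of `(F, U)`: `F' = F ∨ H` for some nonempty union-closed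
family `H` with `(⋃ H) ∩ U = ∅`. -/
def IsExtension {α : Type*} [DecidableEq α] (F : Finset (Finset α)) (U : Finset α)
    (F' : Finset (Finset α)) : Prop :=
  ∃ H : Finset (Finset α), H.Nonempty ∧ UnionClosed H ∧ (H.sup id) ∩ U = ∅ ∧ F' = famJoin F H

/-- The restriction of `F` away from `U`: `F_{∖U} = {A ∖ U : A ∈ F}`. -/
def resAway {α : Type*} [DecidableEq α] (F : Finset (Finset α)) (U : Finset α) :
    Finset (Finset α) :=
  F.image (fun A => A \ U)

/-- `E_{F,U}(X)`: the subsets `Y ⊆ U` with `π_F(X ∪ Y) ∩ U = Y` and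
`π_F(X ∪ Y) ⊇ π_F(X ∪ U) \ U`. -/
def Efam {α : Type*} [DecidableEq α] (F : Finset (Finset α)) (U X : Finset α) :
    Finset (Finset α) :=
  U.powerset.filter (fun Y => piF F (X ∪ Y) ∩ U = Y ∧ piF F (X ∪ U) \ U ⊆ piF F (X ∪ Y))

/-- `μ_{F,F'}(U) = (Σ_{X ∈ F'_{∖U}} |E_{F,U}(X)|) / |F'_{∖U}|`. -/
def mu {α : Type*} [DecidableEq α] (F : Finset (Finset α)) (U : Finset α)
    (F' : Finset (Finset α)) : ℚ :=
  (∑ X ∈ resAway F' U, ((Efam F U X).card : ℚ)) / ((resAway F' U).card : ℚ)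

/-- The union-closed family generated by `G` (all unions of subfamilies of `G`;
it contains `∅` as the empty union). -/
def genUC {α : Type*} [DecidableEq α] (G : Finset (Finset α)) : Finset (Finset α) :=
  G.powerset.image (fun S => S.sup id)

/-- The lattice neighborhood `𝒩_F(U)`: the union-closed family generated by `{∅}`
together with the generators of `F` meeting `U`. -/
def latNbhd {α : Type*} [DecidableEq α] (F : Finset (Finset α)) (U : Finset α) :
    Finset (Finset α) :=
  genUC ((gens F).filter (fun V => (V ∩ U).Nonempty))

/-- The third lattice neighborhood `𝒩³_F(U) = 𝒩_F(⋃ 𝒩_F(U))`. -/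
def latNbhd3 {α : Type*} [DecidableEq α] (F : Finset (Finset α)) (U : Finset α) :
    Finset (Finset α) :=
  latNbhd F ((latNbhd F U).sup id)

/-- The neighborhood `N_F(X) = X ∪ ⋃ {V ∈ J(F) : V ∩ X ≠ ∅}`. -/
def nbhd {α : Type*} [DecidableEq α] (F : Finset (Finset α)) (X : Finset α) : Finset α :=
  X ∪ ((gens F).filter (fun V => (V ∩ X).Nonempty)).sup id

/-- `H` is a filter of `2^S`: a nonempty family of subsets of `S` closed upward in `S`. -/
def IsFilterOn {α : Type*} [DecidableEq α] (S : Finset α) (H : Finset (Finset α)) : Prop :=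
  H.Nonempty ∧ (∀ X ∈ H, X ⊆ S) ∧ ∀ X ∈ H, ∀ Y, X ⊆ Y → Y ⊆ S → Y ∈ H

/-- `F'` minimizes `μ` in `D` (among extensions of `(F, U)` with union inside `D`). -/
def MinimizesMu {α : Type*} [DecidableEq α] (F : Finset (Finset α)) (U D : Finset α)
    (F' : Finset (Finset α)) : Prop :=
  F'.sup id ⊆ D ∧ ∀ F'', IsExtension F U F'' → F''.sup id ⊆ D → mu F U F' ≤ mu F U F''

/-- The degree of `U` in the graph `G`: the number of members of `G` other than `U`
meeting `U`. -/
def degG {α : Type*} [DecidableEq α] (G : Finset (Finset α)) (U : Finset α) : ℕ :=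
  (G.filter (fun V => V ≠ U ∧ (V ∩ U).Nonempty)).card

section UnionClosedFamilies

variable {α : Type*} [DecidableEq α]

lemma mem_piF {F : Finset (Finset α)} {X : Finset α} {x : α} :
    x ∈ piF F X ↔ ∃ A ∈ F, A ⊆ X ∧ x ∈ A := by
  simp [piF, mem_sup, and_assoc]

lemma mem_genUC {G : Finset (Finset α)} {A : Finset α} :
    A ∈ genUC G ↔ ∃ S ⊆ G, S.sup id = A := by
  simp [genUC]

lemma mem_famJoin {F H : Finset (Finset α)} {C : Finset α} :
    C ∈ famJoin F H ↔ ∃ A ∈ F, ∃ B ∈ H, A ∪ B = C := by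
  simp only [famJoin, mem_image, mem_product, Prod.exists]
  grind

/-- Every element of a member of `F` lies in a generator contained in that member. -/
lemma exists_gens_of_mem {F : Finset (Finset α)} {x : α} (A : Finset α) (hA : A ∈ F)
    (hx : x ∈ A) : ∃ V ∈ gens F, V ⊆ A ∧ x ∈ V := by
  induction A using Finset.strongInduction with
  | H A ih =>
    by_cases h : (F.filter (fun B => B ⊂ A)).sup id = A
    · rw [← h] at hx
      obtain ⟨B, hB, hxB⟩ := mem_sup.1 hx
      obtain ⟨hBF, hBA⟩ := mem_filter.1 hB
      obtain ⟨V, hV, hVB, hxV⟩ := ih B hBA hBF hxB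
      exact ⟨V, hV, hVB.trans hBA.subset, hxV⟩
    · exact ⟨A, mem_filter.2 ⟨hA, ⟨x, hx⟩, h⟩, Subset.rfl, hx⟩

lemma mem_piF_iff_gens {F : Finset (Finset α)} {X : Finset α} {x : α} :
    x ∈ piF F X ↔ ∃ V ∈ gens F, V ⊆ X ∧ x ∈ V := by
  rw [mem_piF]
  constructor
  · rintro ⟨A, hA, hAX, hx⟩
    obtain ⟨V, hV, hVA, hxV⟩ := exists_gens_of_mem A hA hx
    exact ⟨V, hV, hVA.trans hAX, hxV⟩
  · rintro ⟨V, hV, h⟩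
    exact ⟨V, (mem_filter.1 hV).1, h⟩

lemma mem_piF_genUC {G : Finset (Finset α)} {X : Finset α} {x : α} :
    x ∈ piF (genUC G) X ↔ ∃ V ∈ G, V ⊆ X ∧ x ∈ V := by
  rw [mem_piF]
  constructor
  · rintro ⟨A, hA, hAX, hx⟩
    obtain ⟨S, hS, rfl⟩ := mem_genUC.1 hA
    obtain ⟨V, hV, hxV⟩ := mem_sup.1 hx
    exact ⟨V, hS hV, (le_sup (f := id) hV).trans hAX, hxV⟩
  · rintro ⟨V, hV, h⟩
    exact ⟨V, mem_genUC.2 ⟨{V}, by simpa using hV, by simp⟩, h⟩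

lemma mem_sup_genUC {G : Finset (Finset α)} {x : α} :
    x ∈ (genUC G).sup id ↔ ∃ V ∈ G, x ∈ V := by
  rw [mem_sup]
  constructor
  · rintro ⟨A, hA, hx⟩
    obtain ⟨S, hS, rfl⟩ := mem_genUC.1 hA
    obtain ⟨V, hV, hxV⟩ := mem_sup.1 hx
    exact ⟨V, hS hV, hxV⟩
  · rintro ⟨V, hV, h⟩
    exact ⟨V, mem_genUC.2 ⟨{V}, by simpa using hV, by simp⟩, h⟩

lemma empty_mem_genUC (G : Finset (Finset α)) : ∅ ∈ genUC G :=
  mem_genUC.2 ⟨∅, by simp, by simp⟩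

lemma unionClosed_genUC (G : Finset (Finset α)) : UnionClosed (genUC G) := by
  intro A hA B hB
  obtain ⟨S, hS, rfl⟩ := mem_genUC.1 hA
  obtain ⟨T, hT, rfl⟩ := mem_genUC.1 hB
  exact mem_genUC.2 ⟨S ∪ T, union_subset hS hT, sup_union⟩

/-- A union-closed family containing `∅` is generated by its generators. -/
lemma genUC_gens {F : Finset (Finset α)} (hUC : UnionClosed F) (hempty : ∅ ∈ F) :
    genUC (gens F) = F := by
  ext A
  rw [mem_genUC]
  constructor
  · rintro ⟨S, hS, rfl⟩
    exact sup_induction (p := (· ∈ F)) hempty (fun A hA B hB => hUC A hA B hB)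
      fun V hV => (mem_filter.1 (hS hV)).1
  · intro hA
    refine ⟨(gens F).filter (· ⊆ A), filter_subset _ _, ?_⟩
    ext x
    simp only [mem_sup, mem_filter, id]
    constructor
    · rintro ⟨V, ⟨-, hVA⟩, hx⟩
      exact hVA hx
    · intro hx
      obtain ⟨V, hV, hVA, hxV⟩ := exists_gens_of_mem A hA hx
      exact ⟨V, ⟨hV, hVA⟩, hxV⟩

lemma famJoin_genUC (G₁ G₂ : Finset (Finset α)) :
    famJoin (genUC G₁) (genUC G₂) = genUC (G₁ ∪ G₂) := by
  ext C
  rw [mem_famJoin]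
  constructor
  · rintro ⟨A, hA, B, hB, rfl⟩
    obtain ⟨S, hS, rfl⟩ := mem_genUC.1 hA
    obtain ⟨T, hT, rfl⟩ := mem_genUC.1 hB
    exact mem_genUC.2 ⟨S ∪ T, union_subset_union hS hT, sup_union⟩
  · intro hC
    obtain ⟨S, hS, rfl⟩ := mem_genUC.1 hC
    refine ⟨_, mem_genUC.2 ⟨S ∩ G₁, inter_subset_right, rfl⟩,
      _, mem_genUC.2 ⟨S ∩ G₂, inter_subset_right, rfl⟩, ?_⟩
    rw [← sup_eq_union, ← sup_union, ← inter_union_distrib_left, inter_eq_left.2 hS]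

lemma famJoin_assoc (F G H : Finset (Finset α)) :
    famJoin (famJoin F G) H = famJoin F (famJoin G H) := by
  ext C
  simp only [mem_famJoin]
  constructor
  · rintro ⟨_, ⟨A, hA, B, hB, rfl⟩, D, hD, rfl⟩
    exact ⟨A, hA, _, ⟨B, hB, D, hD, rfl⟩, (union_assoc _ _ _).symm⟩
  · rintro ⟨A, hA, _, ⟨B, hB, D, hD, rfl⟩, rfl⟩
    exact ⟨_, ⟨A, hA, B, hB, rfl⟩, D, hD, union_assoc _ _ _⟩

lemma UnionClosed.famJoin {F H : Finset (Finset α)} (hF : UnionClosed F)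
    (hH : UnionClosed H) : UnionClosed (famJoin F H) := by
  intro C hC D hD
  obtain ⟨A, hA, B, hB, rfl⟩ := mem_famJoin.1 hC
  obtain ⟨A', hA', B', hB', rfl⟩ := mem_famJoin.1 hD
  exact mem_famJoin.2 ⟨_, hF A hA A' hA', _, hH B hB B' hB', union_union_union_comm _ _ _ _⟩

lemma mem_sup_latNbhd {F : Finset (Finset α)} {U : Finset α} {x : α} :
    x ∈ (latNbhd F U).sup id ↔ ∃ V ∈ gens F, (V ∩ U).Nonempty ∧ x ∈ V := by
  simp only [latNbhd, mem_sup_genUC, mem_filter, and_assoc]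

lemma subset_sup_latNbhd {F : Finset (Finset α)} {U : Finset α} (hU : U ⊆ F.sup id) :
    U ⊆ (latNbhd F U).sup id := by
  intro x hx
  obtain ⟨A, hA, hxA⟩ := mem_sup.1 (hU hx)
  obtain ⟨V, hV, -, hxV⟩ := exists_gens_of_mem A hA hxA
  exact mem_sup_latNbhd.2 ⟨V, hV, ⟨x, mem_inter.2 ⟨hxV, hx⟩⟩, hxV⟩

lemma mem_piF_latNbhd {F : Finset (Finset α)} {M X : Finset α} {x : α} :
    x ∈ piF (latNbhd F M) X ↔ ∃ V ∈ gens F, (V ∩ M).Nonempty ∧ V ⊆ X ∧ x ∈ V := by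
  simp [latNbhd, mem_piF_genUC, and_assoc]

/-- The elements of `π_F(X)` lying in `U ⊆ M` are determined by the generators meeting `M`. -/
lemma piF_latNbhd_inter {F : Finset (Finset α)} {U M X : Finset α} (hUM : U ⊆ M) :
    piF (latNbhd F M) X ∩ U = piF F X ∩ U := by
  ext x
  rw [mem_inter, mem_inter, mem_piF_latNbhd, mem_piF_iff_gens]
  constructor
  · rintro ⟨⟨V, hV, -, h⟩, hx⟩
    exact ⟨⟨V, hV, h⟩, hx⟩
  · rintro ⟨⟨V, hV, hVX, hxV⟩, hx⟩
    exact ⟨⟨V, hV, ⟨x, mem_inter.2 ⟨hxV, hUM hx⟩⟩, hVX, hxV⟩, hx⟩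

lemma subset_of_subset_union_of_disjoint {V X U Y : Finset α} (h : V ⊆ X ∪ U)
    (hVU : ¬ (V ∩ U).Nonempty) : V ⊆ X ∪ Y := by
  intro y hy
  rcases mem_union.1 (h hy) with hyX | hyU
  · exact mem_union_left _ hyX
  · exact absurd ⟨y, mem_inter.2 ⟨hy, hyU⟩⟩ hVU

lemma Efam_latNbhd3 {F : Finset (Finset α)} {U : Finset α} (hU : U ⊆ F.sup id)
    (X : Finset α) : Efam (latNbhd3 F U) U X = Efam F U X := by
  have hUM := subset_sup_latNbhd hU
  unfold Efam
  refine filter_congr fun Y _ => ?_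
  rw [latNbhd3, piF_latNbhd_inter hUM]
  refine and_congr_right fun _ => ?_
  constructor
  · intro h x hx
    obtain ⟨hxF, hxU⟩ := mem_sdiff.1 hx
    obtain ⟨V, hV, hVX, hxV⟩ := mem_piF_iff_gens.1 hxF
    by_cases hVU : (V ∩ U).Nonempty
    · have hVM := hVU.mono (inter_subset_inter_left (s := V) hUM)
      obtain ⟨W, hW, -, hWX⟩ := mem_piF_latNbhd.1
        (h (mem_sdiff.2 ⟨mem_piF_latNbhd.2 ⟨V, hV, hVM, hVX, hxV⟩, hxU⟩))
      exact mem_piF_iff_gens.2 ⟨W, hW, hWX⟩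
    · exact mem_piF_iff_gens.2 ⟨V, hV, subset_of_subset_union_of_disjoint hVX hVU, hxV⟩
  · intro h x hx
    obtain ⟨hxN, hxU⟩ := mem_sdiff.1 hx
    obtain ⟨V, hV, hVM, hVX, hxV⟩ := mem_piF_latNbhd.1 hxN
    by_cases hVU : (V ∩ U).Nonempty
    · obtain ⟨W, hW, hWX, hxW⟩ := mem_piF_iff_gens.1
        (h (mem_sdiff.2 ⟨mem_piF_iff_gens.2 ⟨V, hV, hVX, hxV⟩, hxU⟩))
      have hxM := mem_sup_latNbhd.2 ⟨V, hV, hVU, hxV⟩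
      exact mem_piF_latNbhd.2 ⟨W, hW, ⟨x, mem_inter.2 ⟨hxW, hxM⟩⟩, hWX, hxW⟩
    · exact mem_piF_latNbhd.2
        ⟨V, hV, hVM, subset_of_subset_union_of_disjoint hVX hVU, hxV⟩

/-- An extension of `(F, U)` is an extension of `(𝒩_F(M), U)` whenever `U ⊆ M`. -/
lemma IsExtension.latNbhd {F F' : Finset (Finset α)} {U M : Finset α}
    (hUC : UnionClosed F) (hempty : ∅ ∈ F) (hUM : U ⊆ M) (hext : IsExtension F U F') :
    IsExtension (latNbhd F M) U F' := by
  obtain ⟨H, ⟨B, hB⟩, hHUC, hHU, rfl⟩ := hext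
  refine ⟨famJoin (genUC ((gens F).filter fun V => ¬ (V ∩ M).Nonempty)) H,
    ⟨_, mem_famJoin.2 ⟨∅, empty_mem_genUC _, B, hB, rfl⟩⟩,
    (unionClosed_genUC _).famJoin hHUC, ?_, ?_⟩
  · refine eq_empty_of_forall_notMem fun x hx => ?_
    obtain ⟨hxs, hxU⟩ := mem_inter.1 hx
    obtain ⟨C, hC, hxC⟩ := mem_sup.1 hxs
    obtain ⟨A, hA, D, hD, rfl⟩ := mem_famJoin.1 hC
    rcases mem_union.1 hxC with hxA | hxD
    · obtain ⟨V, hV, hxV⟩ := mem_sup_genUC.1 (mem_sup.2 ⟨A, hA, hxA⟩)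
      exact (mem_filter.1 hV).2 ⟨x, mem_inter.2 ⟨hxV, hUM hxU⟩⟩
    · have : x ∈ H.sup id ∩ U := mem_inter.2 ⟨mem_sup.2 ⟨D, hD, hxD⟩, hxU⟩
      simp [hHU] at this
  · rw [← famJoin_assoc, _root_.latNbhd, famJoin_genUC, filter_union_filter_not_eq,
      genUC_gens hUC hempty]

end UnionClosedFamilies

/-- Theorem 3.12: if `F'` is an extension of `(F, U)`, then `F'` is also an
extension of `(𝒩³_F(U), U)` and `μ_{F,F'}(U) = μ_{𝒩³_F(U),F'}(U)`. -/
theorem stmt9 {α : Type*} [DecidableEq α] (F F' : Finset (Finset α)) (U : Finset α)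
    (hUC : UnionClosed F) (hempty : ∅ ∈ F) (hU : U ⊆ F.sup id)
    (hext : IsExtension F U F') :
    IsExtension (latNbhd3 F U) U F' ∧ mu F U F' = mu (latNbhd3 F U) U F' := by
  refine ⟨hext.latNbhd hUC hempty (subset_sup_latNbhd hU), ?_⟩
  simp only [mu, Efam_latNbhd3 hU]
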